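/- Let C ⊆ ℝⁿ be a closed set. Then there exists an infinitely differentiable function f : ℝⁿ → ℝ such that: (i) f(x) ≥ 0 for all x ∈ ℝⁿ; (ii) f⁻¹({0}) = C; and (iii) for every k ≥ 1 and every x ∈ C, the k-th iterated derivative of f at x vanishes (all iterated partial derivatives of f of all orders are zero at every point of C). The same statement holds with f ≤ 0 in place of f ≥ 0. -/

import Mathlib

/-- All derivatives of a smooth function vanish on the closure of any open set on which the
function vanishes. -/
theorem ContDiff.iteratedFDeriv_eq_zero_of_mem_closure {E F : Type*} [NormedAddCommGroup E]
    [NormedSpace ℝ E] [NormedAddCommGroup F] [NormedSpace ℝ F] {f : E → F}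
    (hf : ContDiff ℝ (⊤ : ℕ∞) f) {U : Set E} (hU : IsOpen U) (hfU : ∀ y ∈ U, f y = 0) {x : E}
    (hx : x ∈ closure U) (k : ℕ) : iteratedFDeriv ℝ k f x = 0 := by
  have hcont : Continuous (iteratedFDeriv ℝ k f) :=
    hf.continuous_iteratedFDeriv (mod_cast le_top)
  refine closure_minimal (fun y hy => ?_) (isClosed_singleton.preimage hcont) hx
  have hev : f =ᶠ[nhds y] 0 := Filter.eventually_of_mem (hU.mem_nhds hy) hfU
  have := (hev.iteratedFDeriv ℝ k).eq_of_nhds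
  simpa using this

/-- Composing on the left with a function that is flat at `f x` gives a function flat at `x`. -/
theorem iteratedFDeriv_comp_eq_zero_of_flat {E F G : Type*} [NormedAddCommGroup E]
    [NormedSpace ℝ E] [NormedAddCommGroup F] [NormedSpace ℝ F] [NormedAddCommGroup G]
    [NormedSpace ℝ G] {g : F → G} {f : E → F} (hg : ContDiff ℝ (⊤ : ℕ∞) g)
    (hf : ContDiff ℝ (⊤ : ℕ∞) f) {x : E} (hflat : ∀ i, iteratedFDeriv ℝ i g (f x) = 0) (k : ℕ) :
    iteratedFDeriv ℝ k (g ∘ f) x = 0 := by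
  set D : ℝ := 1 + ∑ i ∈ Finset.range (k + 1), ‖iteratedFDeriv ℝ i f x‖
  have hsum : 0 ≤ ∑ i ∈ Finset.range (k + 1), ‖iteratedFDeriv ℝ i f x‖ := by positivity
  have hD : ∀ i, 1 ≤ i → i ≤ k → ‖iteratedFDeriv ℝ i f x‖ ≤ D ^ i := fun i hi hik =>
    calc ‖iteratedFDeriv ℝ i f x‖
        ≤ ∑ j ∈ Finset.range (k + 1), ‖iteratedFDeriv ℝ j f x‖ :=
          Finset.single_le_sum (f := fun j => ‖iteratedFDeriv ℝ j f x‖)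
            (fun _ _ => norm_nonneg _) (Finset.mem_range.2 (by omega))
      _ ≤ D := by linarith
      _ ≤ D ^ i := le_self_pow₀ (by linarith) (by omega)
  have h := norm_iteratedFDeriv_comp_le (C := 0) hg hf (mod_cast le_top) x
    (fun i _ => by simp [hflat i]) hD
  simpa using h

/-- All derivatives of `expNegInvGlue` vanish at the origin. -/
theorem expNegInvGlue.iteratedFDeriv_zero (k : ℕ) : iteratedFDeriv ℝ k expNegInvGlue 0 = 0 :=
  expNegInvGlue.contDiff.iteratedFDeriv_eq_zero_of_mem_closure isOpen_Iio
    (fun _ hy => expNegInvGlue.zero_of_nonpos (le_of_lt hy)) (by simp [closure_Iio]) k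

/-- Every closed subset of a finite-dimensional space is the zero set of a nonnegative smooth
function all of whose derivatives vanish on that subset. -/
theorem exists_contDiff_nonneg_preimage_zero_eq_flat {E : Type*} [NormedAddCommGroup E]
    [NormedSpace ℝ E] [FiniteDimensional ℝ E] {C : Set E} (hC : IsClosed C) :
    ∃ f : E → ℝ, ContDiff ℝ (⊤ : ℕ∞) f ∧ (∀ x, 0 ≤ f x) ∧ f ⁻¹' {0} = C ∧
      ∀ k : ℕ, ∀ x ∈ C, iteratedFDeriv ℝ k f x = 0 := by
  obtain ⟨g, hgC, hg, hg₀⟩ := hC.isOpen_compl.exists_contDiff_support_eq (n := ⊤)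
  have hzero : ∀ x, g x = 0 ↔ x ∈ C := fun x => by
    rw [← Function.notMem_support, hgC, Set.notMem_compl_iff]
  refine ⟨expNegInvGlue ∘ g, expNegInvGlue.contDiff.comp hg,
    fun x => expNegInvGlue.nonneg _, ?_, fun k x hx => ?_⟩
  · ext x
    have hgx : 0 ≤ g x := (hg₀ (Set.mem_range_self x)).1
    simp [← hzero, hgx.ge_iff_eq']
  · refine iteratedFDeriv_comp_eq_zero_of_flat expNegInvGlue.contDiff hg (fun i => ?_) k
    rw [(hzero x).2 hx, expNegInvGlue.iteratedFDeriv_zero]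

/-- **Whitney's theorem, strengthened.**
For every closed set `C ⊆ ℝⁿ` there is a smooth function `f : ℝⁿ → ℝ` which is nonnegative,
whose zero set is exactly `C`, and all of whose iterated derivatives of order `≥ 1` vanish at
every point of `C`.  The same holds with `f ≤ 0` in place of `f ≥ 0`. -/
theorem whitney_flat_function (n : ℕ) (C : Set (EuclideanSpace ℝ (Fin n)))
    (hC : IsClosed C) :
    (∃ f : EuclideanSpace ℝ (Fin n) → ℝ,
        ContDiff ℝ (⊤ : ℕ∞) f ∧ (∀ x, 0 ≤ f x) ∧ f ⁻¹' {0} = C ∧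
        ∀ k : ℕ, 1 ≤ k → ∀ x ∈ C, iteratedFDeriv ℝ k f x = 0) ∧
    (∃ f : EuclideanSpace ℝ (Fin n) → ℝ,
        ContDiff ℝ (⊤ : ℕ∞) f ∧ (∀ x, f x ≤ 0) ∧ f ⁻¹' {0} = C ∧
        ∀ k : ℕ, 1 ≤ k → ∀ x ∈ C, iteratedFDeriv ℝ k f x = 0) := by
  obtain ⟨f, hf, hf₀, hfC, hflat⟩ := exists_contDiff_nonneg_preimage_zero_eq_flat hC
  refine ⟨⟨f, hf, hf₀, hfC, fun k _ x hx => hflat k x hx⟩,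
    fun x => -f x, hf.neg, fun x => neg_nonpos.2 (hf₀ x), ?_, fun k _ x hx => ?_⟩
  · rw [← hfC]
    ext x
    simp
  · change iteratedFDeriv ℝ k (-f) x = 0
    rw [iteratedFDeriv_neg_apply, hflat k x hx, neg_zero]
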